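/- Level g intersection numbers: let g ≥ 1, set n = 2g+2, and let 1 ≤ i ≤ g. Then I_g(n−i−2, i, 1, 1) = 1 if i = g, and I_g(n−i−2, i, 1, 1) = 0 if i ≤ g−1. -/

import Mathlib

open Finset

/-- Three-point fusion rank for sl₂ at level ℓ. -/
def N₃ (ℓ a b c : ℕ) : ℕ :=
  if (a + b + c) % 2 = 0 ∧ a + b + c ≤ 2 * ℓ ∧ a ≤ (a + b + c) / 2 ∧
      b ≤ (a + b + c) / 2 ∧ c ≤ (a + b + c) / 2 then 1 else 0

/-- Auxiliary rank function on the reversed list of weights: the recursion removes the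
first two entries (the last two weights) and inserts μ. -/
def Nrev (ℓ : ℕ) : List ℕ → ℕ
  | [] => 1
  | [a] => if a = 0 then 1 else 0
  | [a, b] => if a = b then 1 else 0
  | [a, b, c] => N₃ ℓ c b a
  | a :: b :: c :: d :: rest =>
      ∑ μ ∈ Finset.range (ℓ + 1), Nrev ℓ (μ :: c :: d :: rest) * N₃ ℓ b a μ
  termination_by l => l.length

/-- The sl₂ rank N(λ₁,…,λₙ) of the conformal blocks bundle V(sl₂,ℓ,λ⃗). -/
def N (ℓ : ℕ) (l : List ℕ) : ℕ := Nrev ℓ l.reverse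

/-- Casimir scalar c(α) = α²/2 + α. -/
def cas (α : ℕ) : ℚ := (α : ℚ) ^ 2 / 2 + α

/-- Fakhruddin's degree of V(sl₂,ℓ,(μ₁,μ₂,μ₃,μ₄)) on M̄₀,₄. -/
def degF (ℓ μ₁ μ₂ μ₃ μ₄ : ℕ) : ℚ :=
  (1 / (2 * ((ℓ : ℚ) + 2))) *
    ((N ℓ [μ₁, μ₂, μ₃, μ₄] : ℚ) * (cas μ₁ + cas μ₂ + cas μ₃ + cas μ₄)
      - ∑ α ∈ Finset.range (ℓ + 1), cas α *
          ((N₃ ℓ μ₁ μ₂ α * N₃ ℓ μ₃ μ₄ α + N₃ ℓ μ₁ μ₃ α * N₃ ℓ μ₂ μ₄ α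
            + N₃ ℓ μ₁ μ₄ α * N₃ ℓ μ₂ μ₃ α : ℕ) : ℚ))

/-- r_ℓ(j,t): determined by r_ℓ(j,t)=0 for t<0 or t>ℓ, r_ℓ(0,0)=1, r_ℓ(0,t)=0 otherwise,
and r_ℓ(j,t) = r_ℓ(j−1,t−1) + r_ℓ(j−1,t+1) for j ≥ 1, 0 ≤ t ≤ ℓ. -/
def rL (ℓ : ℕ) : ℕ → ℤ → ℕ
  | 0, t => if t = 0 then 1 else 0
  | j + 1, t =>
      if t < 0 ∨ (ℓ : ℤ) < t then 0 else rL ℓ j (t - 1) + rL ℓ j (t + 1)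

/-- r_∞(j,t): determined by r_∞(j,t)=0 for t<0 or t>j, r_∞(0,0)=1,
and r_∞(j,t) = r_∞(j−1,t−1) + r_∞(j−1,t+1) for j ≥ 1, 0 ≤ t ≤ j. -/
def rInf : ℕ → ℤ → ℕ
  | 0, t => if t = 0 then 1 else 0
  | j + 1, t =>
      if t < 0 ∨ ((j : ℤ) + 1) < t then 0 else rInf j (t - 1) + rInf j (t + 1)

/-- Fakhruddin's intersection number of D^{sl₂}_{ℓ,(1,…,1)} with the F-curve
F_{j₁,j₂,j₃,j₄}. -/
def IF (ℓ j₁ j₂ j₃ j₄ : ℕ) : ℚ :=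
  ∑ μ₁ ∈ Finset.range (ℓ + 1), ∑ μ₂ ∈ Finset.range (ℓ + 1),
    ∑ μ₃ ∈ Finset.range (ℓ + 1), ∑ μ₄ ∈ Finset.range (ℓ + 1),
      degF ℓ μ₁ μ₂ μ₃ μ₄ * (rL ℓ j₁ (μ₁ : ℤ) : ℚ) * (rL ℓ j₂ (μ₂ : ℤ) : ℚ)
        * (rL ℓ j₃ (μ₃ : ℤ) : ℚ) * (rL ℓ j₄ (μ₄ : ℤ) : ℚ)

/-- Binomial coefficient C(n,m) with integer lower argument, with the convention
C(n,m) = 0 for m < 0. -/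
def chooseZ (n : ℕ) (m : ℤ) : ℕ := if m < 0 then 0 else n.choose m.toNat

theorem N₃_one_right {ℓ a c : ℕ} (ha : a ≤ ℓ) :
    N₃ ℓ a 1 c = (if c = a + 1 ∧ a + 1 ≤ ℓ then 1 else 0) + (if c + 1 = a then 1 else 0) := by
  unfold N₃
  split_ifs <;> omega

theorem sum_mul_N₃_one_right {ℓ a : ℕ} (ha : a ≤ ℓ) (f : ℕ → ℚ) :
    ∑ α ∈ Finset.range (ℓ + 1), f α * (N₃ ℓ a 1 α : ℚ) =
      (if a + 1 ≤ ℓ then f (a + 1) else 0) + (if 1 ≤ a then f (a - 1) else 0) := by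
  have h : ∀ α ∈ Finset.range (ℓ + 1), f α * (N₃ ℓ a 1 α : ℚ) =
      (if α = a + 1 then (if a + 1 ≤ ℓ then f (a + 1) else 0) else 0) +
        (if α = a - 1 then (if 1 ≤ a then f (a - 1) else 0) else 0) := by
    intro α _
    rw [N₃_one_right ha]
    by_cases h1 : α = a + 1
    · subst h1
      have h2 : ¬ a + 1 = a - 1 := by omega
      have h3 : ¬ a + 1 + 1 = a := by omega
      simp [h2, h3]
    · by_cases h2 : α + 1 = a
      · subst h2
        have h3 : ¬ α = α + 1 + 1 := by omega
        simp [h3]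
      · have h3 : ¬ (α = a - 1 ∧ 1 ≤ a) := by omega
        simp only [h1, h2, false_and, if_false, ← ite_and, h3]
        simp
  rw [Finset.sum_congr rfl h, Finset.sum_add_distrib, Finset.sum_ite_eq', Finset.sum_ite_eq',
    if_pos (Finset.mem_range.2 (by omega : a - 1 < ℓ + 1))]
  simp only [Finset.mem_range]
  split_ifs <;> first | rfl | omega

/-- The degree on `(a, b, 1, 1)` vanishes except at `a = b = ℓ`. -/
theorem degF_one_one {ℓ a b : ℕ} (hℓ : 1 ≤ ℓ) (ha : a ≤ ℓ) (hb : b ≤ ℓ) :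
    degF ℓ a b 1 1 = if a = ℓ ∧ b = ℓ then 1 else 0 := by
  have hN : (N ℓ [a, b, 1, 1] : ℚ) =
      ∑ α ∈ Finset.range (ℓ + 1), (N₃ ℓ a b α : ℚ) * (N₃ ℓ 1 1 α : ℚ) := by
    simp [N, Nrev]
  have hS : ∑ α ∈ Finset.range (ℓ + 1), cas α *
      ((N₃ ℓ a b α * N₃ ℓ 1 1 α + N₃ ℓ a 1 α * N₃ ℓ b 1 α
        + N₃ ℓ a 1 α * N₃ ℓ b 1 α : ℕ) : ℚ) =
      ∑ α ∈ Finset.range (ℓ + 1), (cas α * N₃ ℓ a b α) * (N₃ ℓ 1 1 α : ℚ) +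
      ∑ α ∈ Finset.range (ℓ + 1), (2 * cas α * N₃ ℓ b 1 α) * (N₃ ℓ a 1 α : ℚ) := by
    rw [← Finset.sum_add_distrib]
    refine Finset.sum_congr rfl fun α _ => ?_
    push_cast
    ring
  unfold degF
  rw [hN, hS, sum_mul_N₃_one_right hℓ, sum_mul_N₃_one_right hℓ, sum_mul_N₃_one_right ha,
    N₃_one_right hb, N₃_one_right hb]
  have h0 : N₃ ℓ a b 0 = if a = b then 1 else 0 := by
    unfold N₃
    split_ifs <;> omega
  have h2 : N₃ ℓ a b 2 = (if a = b ∧ 1 ≤ a ∧ a + 1 ≤ ℓ then 1 else 0) +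
      (if b = a + 2 then 1 else 0) + (if a = b + 2 then 1 else 0) := by
    unfold N₃
    split_ifs <;> omega
  have hne : (ℓ : ℚ) + 2 ≠ 0 := by positivity
  rw [h0, h2]
  rcases eq_or_ne a b with rfl | hab
  · rcases Nat.eq_zero_or_pos a with rfl | hpos
    · have e1 : ¬ 0 = ℓ := by omega
      simp [hℓ, e1, cas]
      norm_num
    · obtain ⟨k, rfl⟩ : ∃ k, a = k + 1 := ⟨a - 1, by omega⟩
      have e1 : ¬ k = k + 1 + 1 := by omega
      have e2 : ¬ k + 1 + 1 = k := by omega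
      rcases ha.eq_or_lt with rfl | hlt
      · simp [cas, e1]
        field_simp
        ring
      · have e3 : ¬ k + 1 = ℓ := by omega
        have e4 : 2 ≤ ℓ := by omega
        have e5 : k + 1 + 1 ≤ ℓ := by omega
        simp [cas, e1, e2, e3, e4, e5]
        right
        ring
  · have e0 : ¬ (a = ℓ ∧ b = ℓ) := by omega
    rcases eq_or_ne b (a + 2) with rfl | h3
    · have e4 : 2 ≤ ℓ := by omega
      have e5 : a + 1 ≤ ℓ := by omega
      have e1 : ¬ a = a + 2 + 2 := by omega
      simp [cas, e0, e1, e4, e5]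
      right
      ring
    · rcases eq_or_ne a (b + 2) with rfl | h4
      · have e4 : 2 ≤ ℓ := by omega
        have e1 : ¬ b + 2 + 1 + 1 = b := by omega
        have e5 : b < ℓ := by omega
        have e6 : ¬ b + 1 + 1 = b := by omega
        simp [cas, e0, e1, e4, e5, e6, h3]
        right
        ring
      · have e1 : ¬ a + 1 + 1 = b := by omega
        have e2 : ¬ a - 1 = b + 1 := by omega
        simp [cas, e0, hab, h3, h4, e1, e2]
        intros
        omega

theorem rL_eq_zero_of_lt (ℓ j : ℕ) (t : ℤ) (h : (j : ℤ) < t) : rL ℓ j t = 0 := by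
  induction j generalizing t with
  | zero => simp [rL]; omega
  | succ j ih =>
    push_cast at h
    rw [rL, ih _ (by omega), ih _ (by omega)]
    simp

theorem rL_self {ℓ j : ℕ} (h : j ≤ ℓ) : rL ℓ j j = 1 := by
  induction j with
  | zero => simp [rL]
  | succ j ih =>
    rw [rL, if_neg (by push_cast; omega), rL_eq_zero_of_lt ℓ j (_ + 1) (by push_cast; omega)]
    simpa using ih (by omega)

theorem rL_one {ℓ : ℕ} (h : 1 ≤ ℓ) (t : ℕ) : rL ℓ 1 t = if t = 1 then 1 else 0 := by
  simp only [rL]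
  split_ifs <;> omega

/-- The intersection number with two unit indices. -/
theorem IF_one_one {ℓ : ℕ} (hℓ : 1 ≤ ℓ) (j₁ j₂ : ℕ) :
    IF ℓ j₁ j₂ 1 1 = (rL ℓ j₁ ℓ : ℚ) * (rL ℓ j₂ ℓ : ℚ) := by
  have h : ∀ a ∈ Finset.range (ℓ + 1), ∀ b ∈ Finset.range (ℓ + 1),
      ∑ μ₃ ∈ Finset.range (ℓ + 1), ∑ μ₄ ∈ Finset.range (ℓ + 1),
        degF ℓ a b μ₃ μ₄ * (rL ℓ j₁ (a : ℤ) : ℚ) * (rL ℓ j₂ (b : ℤ) : ℚ)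
          * (rL ℓ 1 (μ₃ : ℤ) : ℚ) * (rL ℓ 1 (μ₄ : ℤ) : ℚ) =
      if a = ℓ then (if b = ℓ then (rL ℓ j₁ ℓ : ℚ) * (rL ℓ j₂ ℓ : ℚ) else 0) else 0 := by
    intro a ha b hb
    rw [Finset.mem_range] at ha hb
    have h1 : 1 ∈ Finset.range (ℓ + 1) := Finset.mem_range.2 (by omega)
    simp only [rL_one hℓ, Nat.cast_ite, Nat.cast_one, Nat.cast_zero, mul_ite, mul_one, mul_zero,
      Finset.sum_ite_eq', h1, if_true,
      degF_one_one hℓ (Nat.le_of_lt_succ ha) (Nat.le_of_lt_succ hb)]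
    by_cases hab : a = ℓ ∧ b = ℓ
    · obtain ⟨rfl, rfl⟩ := hab
      simp
    · rw [not_and] at hab
      simp +contextual [hab]
  unfold IF
  rw [Finset.sum_congr rfl fun a ha => Finset.sum_congr rfl fun b hb => h a ha b hb]
  simp

/-- Level g intersection numbers, with n = 2g+2. -/
theorem level_g_intersection (g i : ℕ) (hg : 1 ≤ g) (hi1 : 1 ≤ i) (hi2 : i ≤ g) :
    (i = g → IF g (2 * g + 2 - i - 2) i 1 1 = 1) ∧
    (i ≤ g - 1 → IF g (2 * g + 2 - i - 2) i 1 1 = 0) := by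
  rw [IF_one_one hg]
  constructor
  · rintro rfl
    rw [show 2 * i + 2 - i - 2 = i by omega, rL_self le_rfl]
    norm_num
  · intro h
    rw [rL_eq_zero_of_lt g i g (by omega)]
    simp
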